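/- One has α(11,2) = 931; more precisely, the maximum cardinality of an independent set in the simple graph underlying the de Bruijn graph B(11,2) equals 931, and this maximum is attained by an independent set that contains the constant word 0^11 and does not contain the constant word 1^11. -/

import Mathlib

/-- The length-(k-1) suffix of `u` equals the length-(k-1) prefix of `v`. -/
def shifts (k q : ℕ) (u v : Fin k → Fin q) : Prop :=
  ∀ i : ℕ, (h : i + 1 < k) → u ⟨i + 1, h⟩ = v ⟨i, by omega⟩

/-- Adjacency in the simple graph underlying the de Bruijn graph B(k,q). -/
def dbAdj (k q : ℕ) (u v : Fin k → Fin q) : Prop :=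
  u ≠ v ∧ (shifts k q u v ∨ shifts k q v u)

/-- A finset of words is independent if no two of its elements are adjacent. -/
def IsIndep (k q : ℕ) (I : Finset (Fin k → Fin q)) : Prop :=
  ∀ u ∈ I, ∀ v ∈ I, ¬ dbAdj k q u v

/-- The independence number α(k,q) of the simple graph underlying B(k,q). -/
noncomputable def alphaDB (k q : ℕ) : ℕ :=
  sSup {n | ∃ I : Finset (Fin k → Fin q), IsIndep k q I ∧ I.card = n}

/-- The cyclic shift by `j` of a word of length 11. -/
def rotate (j : Fin 11) (u : Fin 11 → Fin 2) : Fin 11 → Fin 2 := fun i => u (i + j)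

lemma shifts_eleven_iff (u v : Fin 11 → Fin 2) :
    shifts 11 2 u v ↔ ∀ i : Fin 10, u i.succ = v i.castSucc :=
  ⟨fun h i => h i (by omega), fun h i hi => h ⟨i, by omega⟩⟩

lemma shifts_rotate (j : Fin 11) (u : Fin 11 → Fin 2) :
    shifts 11 2 (rotate j u) (rotate (j + 1) u) := by
  rw [shifts_eleven_iff]
  intro i
  have h : i.succ = i.castSucc + 1 := by simp
  simp only [rotate, h]
  congr 1
  abel

lemma rotate_ne_rotate_add_one {u : Fin 11 → Fin 2} (h0 : u ≠ fun _ => 0) (h1 : u ≠ fun _ => 1)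
    (j : Fin 11) : rotate j u ≠ rotate (j + 1) u := by
  intro h
  have hstep : ∀ i, u (i + 1) = u i := fun i => by
    have := congrFun h (i - j)
    simp only [rotate] at this
    rw [sub_add_cancel, ← add_assoc, sub_add_cancel] at this
    exact this.symm
  have hconst : ∀ i, u i = u 0 := by
    intro i
    induction i using Fin.induction with
    | zero => rfl
    | succ i ih =>
      have h' : i.succ = i.castSucc + 1 := by simp
      rw [h', hstep, ih]
  rcases (by omega : u 0 = 0 ∨ u 0 = 1) with h | h
  · exact h0 (funext fun i => (hconst i).trans h)
  · exact h1 (funext fun i => (hconst i).trans h)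

lemma dbAdj_rotate {u : Fin 11 → Fin 2} (h0 : u ≠ fun _ => 0) (h1 : u ≠ fun _ => 1)
    (j : Fin 11) : dbAdj 11 2 (rotate j u) (rotate (j + 1) u) :=
  ⟨rotate_ne_rotate_add_one h0 h1 j, Or.inl (shifts_rotate j u)⟩

/-- The number of elements of `I`, with multiplicity, among the cyclic shifts of `u`. -/
def orbitCount (I : Finset (Fin 11 → Fin 2)) (u : Fin 11 → Fin 2) : ℕ :=
  ∑ j : Fin 11, if rotate j u ∈ I then 1 else 0

lemma sum_orbitCount (I : Finset (Fin 11 → Fin 2)) : ∑ u, orbitCount I u = 11 * I.card := by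
  have h : ∀ j : Fin 11, (∑ u, if rotate j u ∈ I then 1 else 0) = I.card := by
    intro j
    have := ((Equiv.addRight j).symm.arrowCongr (Equiv.refl (Fin 2))).sum_comp
      (fun u => if u ∈ I then 1 else 0)
    exact this.trans (by simp)
  simp only [orbitCount]
  rw [Finset.sum_comm]
  simp [h]

lemma IsIndep.indicator_add_le {I : Finset (Fin 11 → Fin 2)} (hI : IsIndep 11 2 I)
    {u v : Fin 11 → Fin 2} (h : dbAdj 11 2 u v) :
    (if u ∈ I then 1 else 0) + (if v ∈ I then 1 else 0) ≤ 1 := by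
  by_cases hu : u ∈ I
  · have hv : v ∉ I := fun hv => hI u hu v hv h
    simp [hu, hv]
  · simp only [hu, if_false]
    split_ifs <;> simp

/-- A 0-1 sequence on an 11-cycle without adjacent ones has at most five ones. If it has exactly
five, then it alternates on every even arc both of whose ends carry a zero. -/
lemma sum_le_five_and_alternates {a : Fin 11 → ℕ} (h : ∀ j, a j + a (j + 1) ≤ 1) :
    ∑ j, a j ≤ 5 ∧ (∑ j, a j = 5 → a 0 = 0 →
      (a 2 = 0 → a 1 = 1) ∧ (a 4 = 0 → a 1 = 1 ∧ a 3 = 1) ∧ (a 6 = 0 → a 1 = 1 ∧ a 5 = 1) ∧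
      (a 8 = 0 → a 1 = 1 ∧ a 7 = 1) ∧ (a 10 = 0 → a 1 = 1 ∧ a 9 = 1)) := by
  have hs : ∑ j, a j = a 0 + a 1 + a 2 + a 3 + a 4 + a 5 + a 6 + a 7 + a 8 + a 9 + a 10 := by
    simp [Fin.sum_univ_succ, add_assoc]
  have e0 : a 0 + a 1 ≤ 1 := h 0
  have e1 : a 1 + a 2 ≤ 1 := h 1
  have e2 : a 2 + a 3 ≤ 1 := h 2
  have e3 : a 3 + a 4 ≤ 1 := h 3
  have e4 : a 4 + a 5 ≤ 1 := h 4
  have e5 : a 5 + a 6 ≤ 1 := h 5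
  have e6 : a 6 + a 7 ≤ 1 := h 6
  have e7 : a 7 + a 8 ≤ 1 := h 7
  have e8 : a 8 + a 9 ≤ 1 := h 8
  have e9 : a 9 + a 10 ≤ 1 := h 9
  have e10 : a 10 + a 0 ≤ 1 := h 10
  rw [hs]
  refine ⟨by omega, fun h5 h0 => ⟨fun h => by omega, fun h => ⟨by omega, by omega⟩,
    fun h => ⟨by omega, by omega⟩, fun h => ⟨by omega, by omega⟩, fun h => ⟨by omega, by omega⟩⟩⟩

lemma IsIndep.orbitCount_le_five {I : Finset (Fin 11 → Fin 2)} (hI : IsIndep 11 2 I)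
    {u : Fin 11 → Fin 2} (h0 : u ≠ fun _ => 0) (h1 : u ≠ fun _ => 1) : orbitCount I u ≤ 5 :=
  (sum_le_five_and_alternates fun j => hI.indicator_add_le (dbAdj_rotate h0 h1 j)).1

/-- An upper bound for the contribution of the cyclic shifts of `u`. -/
def orbitBound (u : Fin 11 → Fin 2) : ℕ :=
  5 + ((if u = fun _ => 0 then 6 else 0) + if u = fun _ => 1 then 6 else 0)

lemma sum_orbitBound : ∑ u, orbitBound u = 11 * 932 := by
  simp [orbitBound, Finset.sum_add_distrib]

lemma IsIndep.orbitCount_le {I : Finset (Fin 11 → Fin 2)} (hI : IsIndep 11 2 I)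
    (u : Fin 11 → Fin 2) : orbitCount I u ≤ orbitBound u := by
  by_cases h : u = (fun _ => 0) ∨ u = fun _ => 1
  · have h11 : orbitCount I u ≤ 11 :=
      (Finset.sum_le_sum fun j _ => (by split_ifs <;> simp : _ ≤ 1)).trans (by simp)
    refine h11.trans ?_
    rcases h with rfl | rfl <;> simp only [orbitBound, if_true] <;> omega
  · rw [not_or] at h
    exact (hI.orbitCount_le_five h.1 h.2).trans (Nat.le_add_right _ _)

lemma IsIndep.orbitCount_eq {I : Finset (Fin 11 → Fin 2)} (hI : IsIndep 11 2 I)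
    (hcard : 932 ≤ I.card) (u : Fin 11 → Fin 2) : orbitCount I u = orbitBound u := by
  have hle : ∀ u ∈ Finset.univ, orbitCount I u ≤ orbitBound u := fun u _ => hI.orbitCount_le u
  refine (Finset.sum_eq_sum_iff_of_le hle).mp (le_antisymm (Finset.sum_le_sum hle) ?_) u
    (Finset.mem_univ u)
  rw [sum_orbitBound, sum_orbitCount]
  omega

lemma IsIndep.const_mem {I : Finset (Fin 11 → Fin 2)} (hI : IsIndep 11 2 I)
    (hcard : 932 ≤ I.card) (c : Fin 2) : (fun _ => c) ∈ I := by
  by_contra hc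
  have h := hI.orbitCount_eq hcard fun _ => c
  have h0 : orbitCount I (fun _ => c) = 0 := by
    simp only [orbitCount]
    exact Finset.sum_eq_zero fun j _ => if_neg hc
  rw [h0, orbitBound] at h
  omega

lemma IsIndep.alternates {I : Finset (Fin 11 → Fin 2)} (hI : IsIndep 11 2 I)
    (hcard : 932 ≤ I.card) {u : Fin 11 → Fin 2} (hu0 : u ≠ fun _ => 0) (hu1 : u ≠ fun _ => 1)
    (hu : u ∉ I) :
    (rotate 2 u ∉ I → rotate 1 u ∈ I) ∧
    (rotate 4 u ∉ I → rotate 1 u ∈ I ∧ rotate 3 u ∈ I) ∧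
    (rotate 6 u ∉ I → rotate 1 u ∈ I ∧ rotate 5 u ∈ I) ∧
    (rotate 8 u ∉ I → rotate 1 u ∈ I ∧ rotate 7 u ∈ I) ∧
    (rotate 10 u ∉ I → rotate 1 u ∈ I ∧ rotate 9 u ∈ I) := by
  have h5 : orbitCount I u = 5 := by
    rw [hI.orbitCount_eq hcard u]
    simp [orbitBound, hu0, hu1]
  have hzero : rotate 0 u = u := funext fun i => congrArg u (add_zero i)
  simpa [hzero, hu] using
    (sum_le_five_and_alternates fun j => hI.indicator_add_le (dbAdj_rotate hu0 hu1 j)).2 h5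

lemma dbAdj_of_forall {u v : Fin 11 → Fin 2} (h : u ≠ v)
    (h' : (∀ i : Fin 10, u i.succ = v i.castSucc) ∨ ∀ i : Fin 10, v i.succ = u i.castSucc) :
    dbAdj 11 2 u v :=
  ⟨h, by rwa [shifts_eleven_iff, shifts_eleven_iff]⟩

/-- The word `w`, complemented if `c = 1`. -/
def twist (c : Fin 2) (w : Fin 11 → Fin 2) : Fin 11 → Fin 2 := fun i => w i + c

lemma IsIndep.alternating_mem {I : Finset (Fin 11 → Fin 2)} (hI : IsIndep 11 2 I)
    (hcard : 932 ≤ I.card) (c : Fin 2) : twist c ![0, 1, 0, 1, 0, 1, 0, 1, 0, 1, 0] ∈ I := by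
  have out : ∀ {u v : Fin 11 → Fin 2}, u ∈ I → u ≠ v →
      ((∀ i : Fin 10, u i.succ = v i.castSucc) ∨ ∀ i : Fin 10, v i.succ = u i.castSucc) →
      v ∉ I := fun hu hne h hv => hI _ hu _ hv (dbAdj_of_forall hne h)
  have hc := hI.const_mem hcard c
  obtain ⟨a₁, b₁⟩ := (hI.alternates hcard (u := twist c ![0, 0, 0, 0, 0, 0, 0, 0, 0, 0, 1])
    (by clear * -; decide +revert) (by clear * -; decide +revert)
    (out hc (by clear * -; decide +revert) (by clear * -; decide +revert))).2.2.2.2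
    (out hc (by clear * -; decide +revert) (by clear * -; decide +revert))
  obtain ⟨a₂, b₂⟩ := (hI.alternates hcard (u := twist c ![0, 0, 0, 0, 0, 0, 0, 0, 1, 0, 1])
    (by clear * -; decide +revert) (by clear * -; decide +revert)
    (out a₁ (by clear * -; decide +revert) (by clear * -; decide +revert))).2.2.2.1
    (out b₁ (by clear * -; decide +revert) (by clear * -; decide +revert))
  obtain ⟨a₃, b₃⟩ := (hI.alternates hcard (u := twist c ![0, 0, 0, 0, 0, 0, 1, 0, 1, 0, 1])
    (by clear * -; decide +revert) (by clear * -; decide +revert)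
    (out a₂ (by clear * -; decide +revert) (by clear * -; decide +revert))).2.2.1
    (out b₂ (by clear * -; decide +revert) (by clear * -; decide +revert))
  obtain ⟨a₄, b₄⟩ := (hI.alternates hcard (u := twist c ![0, 0, 0, 0, 1, 0, 1, 0, 1, 0, 1])
    (by clear * -; decide +revert) (by clear * -; decide +revert)
    (out a₃ (by clear * -; decide +revert) (by clear * -; decide +revert))).2.1
    (out b₃ (by clear * -; decide +revert) (by clear * -; decide +revert))
  have a₅ := (hI.alternates hcard (u := twist c ![0, 0, 1, 0, 1, 0, 1, 0, 1, 0, 1])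
    (by clear * -; decide +revert) (by clear * -; decide +revert)
    (out a₄ (by clear * -; decide +revert) (by clear * -; decide +revert))).1
    (out b₄ (by clear * -; decide +revert) (by clear * -; decide +revert))
  convert a₅ using 1
  clear * -
  decide +revert

lemma IsIndep.card_le {I : Finset (Fin 11 → Fin 2)} (hI : IsIndep 11 2 I) : I.card ≤ 931 := by
  by_contra! hcard
  exact hI _ (hI.alternating_mem hcard 0) _ (hI.alternating_mem hcard 1)
    (dbAdj_of_forall (by decide) (by decide))

/-- A bit mask whose set bits are the values `∑ i, u i * 2 ^ i` of the words `u` in an independent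
set of cardinality 931. -/
def indepMask : ℕ :=
  9973319203173015502900771443477926970961425582821209096094321529495517569796990077776567727019933415679356637595169277975957387684692224001046637337736294309019871186855263244841861677315380169118166296186459106750901431930497303214197052475778584238154100728839887832120293393162847656713780551292472984485558164040461904472408916818583341522559165890192638197598886510918543473862507727455409760800374554160318076409307452252050178558452763100315666459702457495124252450104452557311753517665605224283221439246746874823066077392342830904013574242179147693458502722323787927867834431535587150236721468657783033097485

/-- The independent set encoded by `indepMask`. -/
def indepWords : Finset (Fin 11 → Fin 2) :=
  (Finset.univ.filter fun n : Fin (2 ^ 11) => indepMask.testBit n).map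
    finFunctionFinEquiv.symm.toEmbedding

lemma mem_indepWords (u : Fin 11 → Fin 2) :
    u ∈ indepWords ↔ indepMask.testBit (finFunctionFinEquiv u : Fin (2 ^ 11)) := by
  simp [indepWords, Finset.mem_map_equiv]

lemma indepMask_half : ∀ n < 2 ^ 11, ∀ b < 2, indepMask.testBit n →
    n ≠ n / 2 + 2 ^ 10 * b → ¬ indepMask.testBit (n / 2 + 2 ^ 10 * b) := by
  decide +kernel

lemma finFunctionFinEquiv_of_shifts {u v : Fin 11 → Fin 2} (h : shifts 11 2 u v) :
    (finFunctionFinEquiv v : ℕ) = (finFunctionFinEquiv u : ℕ) / 2 + 2 ^ 10 * (v 10 : ℕ) := by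
  rw [shifts_eleven_iff] at h
  rw [finFunctionFinEquiv_apply, finFunctionFinEquiv_apply, Fin.sum_univ_castSucc (n := 10),
    Fin.sum_univ_succ (n := 10)]
  simp only [h, Fin.val_succ, pow_succ, ← mul_assoc, ← Finset.sum_mul]
  have : (u 0 : ℕ) < 2 := (u 0).isLt
  have hl : Fin.last 10 = 10 := rfl
  simp only [hl, Fin.val_castSucc, Fin.val_zero, pow_zero, mul_one]
  norm_num
  omega

lemma not_mem_indepWords_of_shifts {u v : Fin 11 → Fin 2} (hne : u ≠ v) (h : shifts 11 2 u v)
    (hu : u ∈ indepWords) : v ∉ indepWords := by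
  rw [mem_indepWords] at hu ⊢
  have hv := finFunctionFinEquiv_of_shifts h
  rw [hv]
  refine indepMask_half _ (finFunctionFinEquiv u).isLt _ (v 10).isLt hu fun heq => hne ?_
  exact finFunctionFinEquiv.injective (Fin.ext (heq.trans hv.symm))

lemma isIndep_indepWords : IsIndep 11 2 indepWords := by
  rintro u hu v hv ⟨hne, h | h⟩
  · exact not_mem_indepWords_of_shifts hne h hu hv
  · exact not_mem_indepWords_of_shifts hne.symm h hv hu

lemma card_indepWords : indepWords.card = 931 := by
  rw [indepWords, Finset.card_map]
  decide +kernel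

/-- α(11,2) = 931, attained by an independent set containing
the constant word 0^11 and excluding the constant word 1^11. -/
theorem alpha_eleven_two :
    alphaDB 11 2 = 931 ∧
    ∃ I : Finset (Fin 11 → Fin 2), IsIndep 11 2 I ∧ I.card = 931 ∧
      (fun _ => (0 : Fin 2)) ∈ I ∧ (fun _ => (1 : Fin 2)) ∉ I := by
  refine ⟨IsGreatest.csSup_eq ⟨⟨_, isIndep_indepWords, card_indepWords⟩, ?_⟩,
    indepWords, isIndep_indepWords, card_indepWords, ?_, ?_⟩
  · rintro _ ⟨I, hI, rfl⟩
    exact hI.card_le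
  · rw [mem_indepWords]
    decide +kernel
  · rw [mem_indepWords]
    decide +kernel
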